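/- Zero of a continuous vector field (consequence of the Brouwer fixed point theorem, used in the Galerkin step): let N ≥ 1, let P : ℝ^N → ℝ^N be continuous, and let r > 0 be such that ⟨P(λ), λ⟩ ≥ 0 for every λ ∈ ℝ^N with |λ| = r (Euclidean inner product and norm). Then there exists λ ∈ ℝ^N with |λ| ≤ r and P(λ) = 0. -/

import Mathlib

open RealInnerProductSpace

open MeasureTheory Metric Set Polynomial Topology

/-- `t ↦ det (1 + t • A)` is a polynomial function of degree at most the dimension. -/
lemma exists_polynomial_eval_eq_det_one_add_smul {E : Type*} [NormedAddCommGroup E]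
    [NormedSpace ℝ E] [FiniteDimensional ℝ E] (A : E →L[ℝ] E) :
    ∃ p : ℝ[X], p.natDegree ≤ Module.finrank ℝ E ∧
      ∀ t : ℝ, p.eval t = ((1 : E →L[ℝ] E) + t • A).det := by
  classical
  let b := Module.finBasis ℝ E
  let M := LinearMap.toMatrix b b (A : E →ₗ[ℝ] E)
  refine ⟨Matrix.det ((X : ℝ[X]) • M.map C + (1 : Matrix _ _ ℝ).map C), ?_, fun t => ?_⟩
  · simpa using Polynomial.natDegree_det_X_add_C_le M 1
  · have h : LinearMap.toMatrix b b (((1 : E →L[ℝ] E) + t • A : E →L[ℝ] E) : E →ₗ[ℝ] E)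
        = 1 + t • M := by
      have : (((1 : E →L[ℝ] E) + t • A : E →L[ℝ] E) : E →ₗ[ℝ] E)
          = LinearMap.id + t • (A : E →ₗ[ℝ] E) := rfl
      rw [this, map_add, LinearMap.toMatrix_id, map_smul]
    rw [ContinuousLinearMap.det, ← LinearMap.det_toMatrix b, h, ← Polynomial.coe_evalRingHom,
      RingHom.map_det]
    congr 1
    ext i j
    by_cases hij : i = j <;> simp [hij, add_comm, mul_comm (M _ _)]

/-- The value of `det (1 + t • A)` at `t = 1` is recovered by Lagrange interpolation. -/
lemma det_one_add_eq_sum_lagrange {E : Type*} [NormedAddCommGroup E]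
    [NormedSpace ℝ E] [FiniteDimensional ℝ E] (A : E →L[ℝ] E) (s : Finset ℝ)
    (hs : Module.finrank ℝ E < s.card) :
    ((1 : E →L[ℝ] E) + A).det =
      ∑ t ∈ s, ((1 : E →L[ℝ] E) + t • A).det * (Lagrange.basis s id t).eval 1 := by
  obtain ⟨p, hp, hpe⟩ := exists_polynomial_eval_eq_det_one_add_smul A
  have h := Lagrange.eq_interpolate (f := p) (v := id) (s := s) (injOn_id _)
    (lt_of_le_of_lt degree_le_natDegree (by exact_mod_cast hp.trans_lt hs))
  have h1 := congrArg (eval 1) h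
  rw [hpe, one_smul, Lagrange.interpolate_apply, eval_finsetSum] at h1
  rw [h1]
  exact Finset.sum_congr rfl fun t _ => by simp [hpe]

/-- Small perturbations of the identity have positive determinant. -/
lemma det_one_add_smul_pos {E : Type*} [NormedAddCommGroup E]
    [NormedSpace ℝ E] [FiniteDimensional ℝ E] (A : E →L[ℝ] E) {t : ℝ} (ht : 0 ≤ t)
    (hA : t * ‖A‖ < 1) : 0 < ((1 : E →L[ℝ] E) + t • A).det := by
  obtain ⟨p, -, hpe⟩ := exists_polynomial_eval_eq_det_one_add_smul A
  have hne : ∀ s ∈ Icc 0 t, p.eval s ≠ 0 := by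
    intro s hs h0
    rw [hpe] at h0
    obtain ⟨v, hv, hv0⟩ := Submodule.exists_mem_ne_zero_of_ne_bot
      (LinearMap.bot_lt_ker_of_det_eq_zero h0).ne'
    have hv' : v + s • A v = 0 := hv
    have h1 : ‖v‖ = s * ‖A v‖ := by
      have h := congrArg norm (eq_neg_of_add_eq_zero_left hv')
      rwa [norm_neg, norm_smul, Real.norm_of_nonneg hs.1] at h
    have h2 : s * ‖A v‖ ≤ t * (‖A‖ * ‖v‖) :=
      mul_le_mul hs.2 (A.le_opNorm v) (norm_nonneg _) ht
    have h3 : 0 < ‖v‖ := norm_pos_iff.2 hv0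
    nlinarith
  rw [← hpe]
  by_contra! hneg
  have h0 : p.eval 0 = 1 := by
    rw [hpe, zero_smul, add_zero]
    exact LinearMap.det_id
  obtain ⟨s, hs, hs0⟩ := intermediate_value_Icc' ht p.continuous.continuousOn
    (show (0 : ℝ) ∈ Icc (p.eval t) (p.eval 0) from ⟨hneg, by rw [h0]; exact zero_le_one⟩)
  exact hne s hs hs0

/-- A small Lipschitz perturbation of the identity, supported in a ball, maps that ball
bijectively onto itself. -/
lemma bijOn_ball_id_add_smul {E : Type*} [NormedAddCommGroup E] [NormedSpace ℝ E]
    [CompleteSpace E] {g : E → E} {K : NNReal} (hg : LipschitzWith K g) {R : ℝ}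
    (hg0 : ∀ x, R ≤ ‖x‖ → g x = 0) {t : ℝ} (ht : 0 ≤ t) (htK : t * K < 1) :
    BijOn (fun x => x + t • g x) (ball 0 R) (ball 0 R) := by
  lift t to NNReal using ht
  have happ : ApproximatesLinearOn (fun x => x + (t : ℝ) • g x)
      ((ContinuousLinearEquiv.refl ℝ E : E ≃L[ℝ] E) : E →L[ℝ] E) univ (t * K) := by
    intro x _ y _
    have : x + (t : ℝ) • g x - (y + (t : ℝ) • g y)
        - ((ContinuousLinearEquiv.refl ℝ E : E ≃L[ℝ] E) : E →L[ℝ] E) (x - y)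
        = (t : ℝ) • (g x - g y) := by
      simp only [ContinuousLinearEquiv.coe_coe, ContinuousLinearEquiv.refl_apply, smul_sub]
      abel
    rw [this, norm_smul, Real.norm_of_nonneg t.coe_nonneg, NNReal.coe_mul, mul_assoc]
    exact mul_le_mul_of_nonneg_left (hg.norm_sub_le x y) t.coe_nonneg
  have hc : Subsingleton E ∨ t * K <
      ‖(((ContinuousLinearEquiv.refl ℝ E).symm : E ≃L[ℝ] E) : E →L[ℝ] E)‖₊⁻¹ := by
    rcases subsingleton_or_nontrivial E with h | h
    · exact Or.inl h
    · right
      have : ‖(((ContinuousLinearEquiv.refl ℝ E).symm : E ≃L[ℝ] E) : E →L[ℝ] E)‖₊ = 1 :=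
        ContinuousLinearMap.nnnorm_id
      rw [this, inv_one, ← NNReal.coe_lt_coe]
      simpa using htK
  have hinj : Function.Injective fun x => x + (t : ℝ) • g x := injOn_univ.1 (happ.injOn hc)
  have hout : ∀ x, R ≤ ‖x‖ → x + (t : ℝ) • g x = x := fun x hx => by simp [hg0 x hx]
  refine ⟨fun x hx => ?_, hinj.injOn, fun y hy => ?_⟩
  · rw [mem_ball_zero_iff] at hx ⊢
    by_contra! h
    have : x + (t : ℝ) • g x = x := hinj (hout _ h)
    rw [this] at h
    exact h.not_gt hx
  · obtain ⟨x, hx⟩ := happ.surjective hc y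
    refine ⟨x, ?_, hx⟩
    rw [mem_ball_zero_iff] at hy ⊢
    by_contra! h
    have : x = y := (hout x h).symm.trans hx
    rw [this] at h
    exact h.not_gt hy

/-- A function that is Lipschitz on a closed ball and vanishes on the bounding sphere remains
Lipschitz when extended by zero. -/
lemma LipschitzOnWith.indicator_closedBall {E F : Type*} [NormedAddCommGroup E]
    [NormedSpace ℝ E] [NormedAddCommGroup F] {G : E → F} {K : NNReal} {R : ℝ}
    (hG : LipschitzOnWith K G (closedBall 0 R)) (hG0 : ∀ x, ‖x‖ = R → G x = 0) :
    LipschitzWith K ((closedBall 0 R).indicator G) := by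
  have key : ∀ x y : E, ‖x‖ ≤ R → R < ‖y‖ → ‖G x‖ ≤ K * ‖x - y‖ := by
    intro x y hx hy
    have hcont : ContinuousOn (fun s : ℝ => ‖AffineMap.lineMap x y s‖) (Icc 0 1) :=
      (AffineMap.lineMap_continuous.norm).continuousOn
    obtain ⟨s, hs, hsR⟩ := intermediate_value_Icc zero_le_one hcont
      (show R ∈ Icc _ _ by simpa using ⟨hx, hy.le⟩)
    have h1 := hG.norm_sub_le (x := x) (by simpa using hx)
      (y := AffineMap.lineMap x y s) (by simpa using hsR.le)
    rw [hG0 _ hsR, sub_zero] at h1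
    refine h1.trans (mul_le_mul_of_nonneg_left ?_ K.2)
    rw [← dist_eq_norm, dist_left_lineMap, Real.norm_of_nonneg hs.1, dist_eq_norm]
    exact mul_le_of_le_one_left (norm_nonneg _) hs.2
  refine LipschitzWith.of_dist_le_mul fun x y => ?_
  rw [dist_eq_norm, dist_eq_norm]
  by_cases hx : x ∈ closedBall (0 : E) R <;> by_cases hy : y ∈ closedBall (0 : E) R
  · rw [indicator_of_mem hx, indicator_of_mem hy]
    exact hG.norm_sub_le hx hy
  · rw [indicator_of_mem hx, indicator_of_notMem hy, sub_zero]
    exact key x y (by simpa using hx) (by simpa using hy)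
  · rw [indicator_of_notMem hx, indicator_of_mem hy, zero_sub, norm_neg, norm_sub_rev x]
    exact key y x (by simpa using hy) (by simpa using hx)
  · rw [indicator_of_notMem hx, indicator_of_notMem hy, sub_zero, norm_zero]
    positivity

/-- The derivative of a map taking values of constant nonzero norm near `x` is singular. -/
lemma HasFDerivAt.det_eq_zero_of_norm_eq {E : Type*} [NormedAddCommGroup E]
    [InnerProductSpace ℝ E] [FiniteDimensional ℝ E] {h : E → E} {h' : E →L[ℝ] E} {x : E} {R : ℝ}
    (hd : HasFDerivAt h h' x) (hR : 0 < R) (hn : ∀ᶠ y in 𝓝 x, ‖h y‖ = R) : h'.det = 0 := by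
  by_contra hdet
  have hsurj : Function.Surjective (h' : E →ₗ[ℝ] E) := by
    have hu : IsUnit (h' : E →ₗ[ℝ] E) :=
      (LinearMap.isUnit_iff_isUnit_det _).2 (isUnit_iff_ne_zero.2 hdet)
    exact ((Module.End.isUnit_iff _).1 hu).2
  obtain ⟨v, hv⟩ := hsurj (h x)
  have hv : h' v = h x := hv
  have h1 := hd.norm_sq
  have h2 : HasFDerivAt (fun y => ‖h y‖ ^ 2) (0 : E →L[ℝ] ℝ) x :=
    (hasFDerivAt_const (R ^ 2) x).congr_of_eventuallyEq (hn.mono fun y hy => by simp [hy])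
  have h3 := congrArg (fun L : E →L[ℝ] ℝ => L v) (h1.unique h2)
  simp [hv] at h3
  have := hn.self_of_nhds
  rw [h3, norm_zero] at this
  exact hR.ne this

/-- There is no `C¹` retraction of a closed ball onto its bounding sphere. -/
theorem not_exists_contDiff_retraction_sphere {E : Type*} [NormedAddCommGroup E]
    [InnerProductSpace ℝ E] [FiniteDimensional ℝ E] [MeasurableSpace E] [BorelSpace E]
    {R : ℝ} (hR : 0 < R) {h : E → E} (hh : ContDiff ℝ 1 h)
    (hid : ∀ x, ‖x‖ = R → h x = x) (hn : ∀ x, ‖x‖ ≤ R → ‖h x‖ = R) : False := by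
  obtain ⟨K, hK⟩ := (hh.sub contDiff_id).contDiffOn.exists_lipschitzOnWith one_ne_zero
    (convex_closedBall (0 : E) R) (isCompact_closedBall 0 R)
  let g : E → E := (closedBall 0 R).indicator (h - id)
  have hg0 : ∀ x : E, ‖x‖ = R → (h - id : E → E) x = 0 := fun x hx => by simp [hid x hx]
  have hg : LipschitzWith K g := hK.indicator_closedBall hg0
  have hgout : ∀ x, R ≤ ‖x‖ → g x = 0 := by
    intro x hx
    rcases hx.eq_or_lt with hx | hx
    · exact indicator_apply_eq_zero.2 fun _ => hg0 x hx.symm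
    · exact indicator_of_notMem (by simpa using hx) _
  have hev : ∀ x ∈ ball (0 : E) R, g =ᶠ[𝓝 x] (h - id) := fun x hx => by
    filter_upwards [isOpen_ball.mem_nhds hx] with y hy
    exact indicator_of_mem (ball_subset_closedBall hy) _
  have hdiff : ∀ x ∈ ball (0 : E) R, HasFDerivAt g (fderiv ℝ g x) x := fun x hx =>
    ((hev x hx).differentiableAt_iff.2
      ((hh.sub contDiff_id).differentiable one_ne_zero x)).hasFDerivAt
  have hdet0 : ∀ x ∈ ball (0 : E) R, ((1 : E →L[ℝ] E) + fderiv ℝ g x).det = 0 := by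
    intro x hx
    have h1 : HasFDerivAt (fun y => y + g y) ((1 : E →L[ℝ] E) + fderiv ℝ g x) x :=
      (hasFDerivAt_id x).add (hdiff x hx)
    refine h1.det_eq_zero_of_norm_eq hR ?_
    filter_upwards [hev x hx, isOpen_ball.mem_nhds hx] with y hy hyR
    rw [hy]
    simpa using hn y (mem_ball_zero_iff.1 hyR).le
  have hKpos : (0 : ℝ) < 1 / (K + 1) := by positivity
  have hvol : ∀ t ∈ Ioo (0 : ℝ) (1 / (K + 1)),
      IntegrableOn (fun x => ((1 : E →L[ℝ] E) + t • fderiv ℝ g x).det) (ball 0 R) ∧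
      ∫ x in ball (0 : E) R, ((1 : E →L[ℝ] E) + t • fderiv ℝ g x).det =
        volume.real (ball (0 : E) R) := by
    intro t ht
    have htK : t * K < 1 := by
      have := (lt_div_iff₀ (by positivity)).1 ht.2
      nlinarith [ht.1]
    have hbij := bijOn_ball_id_add_smul hg hgout ht.1.le htK
    have hd : ∀ x ∈ ball (0 : E) R, HasFDerivWithinAt (fun x => x + t • g x)
        ((1 : E →L[ℝ] E) + t • fderiv ℝ g x) (ball 0 R) x := fun x hx =>
      ((hasFDerivAt_id x).add ((hdiff x hx).const_smul t)).hasFDerivWithinAt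
    have habs : EqOn (fun x => |((1 : E →L[ℝ] E) + t • fderiv ℝ g x).det| • (1 : ℝ))
        (fun x => ((1 : E →L[ℝ] E) + t • fderiv ℝ g x).det) (ball 0 R) := fun x _ => by
      have hle := norm_fderiv_le_of_lipschitz ℝ hg (x₀ := x)
      have := det_one_add_smul_pos (fderiv ℝ g x) ht.1.le
        ((mul_le_mul_of_nonneg_left hle ht.1.le).trans_lt htK)
      simp [abs_of_pos this]
    constructor
    · refine IntegrableOn.congr_fun ?_ habs measurableSet_ball
      rw [← integrableOn_image_iff_integrableOn_abs_det_fderiv_smul volume measurableSet_ball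
        hd hbij.injOn (fun _ => (1 : ℝ)), hbij.image_eq]
      exact integrableOn_const measure_ball_lt_top.ne
    · rw [← setIntegral_congr_fun measurableSet_ball habs,
        ← integral_image_eq_integral_abs_det_fderiv_smul volume measurableSet_ball
        hd hbij.injOn (fun _ => (1 : ℝ)), hbij.image_eq]
      simp
  obtain ⟨s, hs, hcard⟩ :=
    (Ioo_infinite hKpos).exists_subset_card_eq (Module.finrank ℝ E + 1)
  have hlt : Module.finrank ℝ E < s.card := by omega
  have hw : ∑ t ∈ s, (Lagrange.basis s id t).eval (1 : ℝ) = 1 := by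
    have h1 := det_one_add_eq_sum_lagrange (0 : E →L[ℝ] E) s hlt
    have h2 : (1 : E →L[ℝ] E).det = 1 := LinearMap.det_id
    simpa [h2] using h1.symm
  have hzero : ∫ x in ball (0 : E) R, ((1 : E →L[ℝ] E) + fderiv ℝ g x).det = 0 := by
    rw [setIntegral_congr_fun measurableSet_ball (g := fun _ => (0 : ℝ)) hdet0]
    simp
  simp_rw [fun x => det_one_add_eq_sum_lagrange (fderiv ℝ g x) s hlt] at hzero
  rw [integral_finsetSum _ fun t ht => ((hvol t (hs ht)).1.mul_const _)] at hzero
  simp_rw [integral_mul_const] at hzero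
  rw [Finset.sum_congr rfl fun t ht => by rw [(hvol t (hs ht)).2], ← Finset.mul_sum, hw,
    mul_one] at hzero
  exact (ENNReal.toReal_pos (measure_ball_pos volume (0 : E) hR).ne'
    measure_ball_lt_top.ne).ne' hzero

/-- A continuous vector field equal to the identity outside some ball has a zero. -/
theorem exists_eq_zero_of_eq_id_off_ball {E : Type*} [NormedAddCommGroup E]
    [InnerProductSpace ℝ E] [FiniteDimensional ℝ E] {Q : E → E} (hQ : Continuous Q) {R : ℝ}
    (hR : 0 < R) (hid : ∀ x, R ≤ ‖x‖ → Q x = x) : ∃ x, Q x = 0 := by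
  borelize E
  by_contra! hne
  obtain ⟨F, hF, hFd, hFid, -⟩ := hQ.exists_contDiff_approx_and_eqOn 1 hQ.norm
    (fun x => norm_pos_iff.2 (hne x)) (S := {x | R + 1 ≤ ‖x‖}) (U := {x | R < ‖x‖})
    (isClosed_le continuous_const continuous_norm)
    ((isOpen_lt continuous_const continuous_norm).mem_nhdsSet.2 fun x hx =>
      lt_of_lt_of_le (lt_add_one R) hx)
    (contDiffOn_id.congr fun x hx => hid x (le_of_lt hx))
  have hF0 : ∀ x, F x ≠ 0 := fun x h0 => by simpa [h0] using hFd x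
  refine not_exists_contDiff_retraction_sphere (R := R + 1) (by positivity)
    (h := fun x => ((R + 1) / ‖F x‖) • F x) ?_ (fun x hx => ?_) (fun x _ => ?_)
  · have hF1 : ContDiff ℝ 1 F := hF
    exact (contDiff_const.div (hF1.norm ℝ hF0) fun x => norm_ne_zero_iff.2 (hF0 x)).smul hF1
  · have : F x = x := (hFid hx.ge).trans (hid x (by linarith))
    rw [this, hx, div_self (by positivity), one_smul]
  · have := norm_ne_zero_iff.2 (hF0 x)
    rw [norm_smul, norm_div, norm_norm, div_mul_cancel₀ _ this, Real.norm_of_nonneg (by positivity)]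

/-- Zero of a continuous vector field (consequence of the Brouwer fixed point
theorem): if `P : ℝᴺ → ℝᴺ` is continuous and `⟨P λ, λ⟩ ≥ 0` whenever `‖λ‖ = r`,
then `P` has a zero in the closed ball of radius `r`. -/
theorem stmt9 (N : ℕ) (hN : 1 ≤ N)
    (P : EuclideanSpace ℝ (Fin N) → EuclideanSpace ℝ (Fin N))
    (hP : Continuous P) (r : ℝ) (hr : 0 < r)
    (hpos : ∀ l : EuclideanSpace ℝ (Fin N), ‖l‖ = r → 0 ≤ ⟪P l, l⟫) :
    ∃ l : EuclideanSpace ℝ (Fin N), ‖l‖ ≤ r ∧ P l = 0 := by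
  by_contra! hne
  let c : EuclideanSpace ℝ (Fin N) → ℝ := fun x => r / max r ‖x‖
  let s : EuclideanSpace ℝ (Fin N) → ℝ := fun x => max 0 (min 1 (‖x‖ / r - 1))
  have hmax : ∀ x : EuclideanSpace ℝ (Fin N), max r ‖x‖ ≠ 0 := fun x =>
    (lt_max_of_lt_left hr).ne'
  have hc : Continuous c := continuous_const.div (continuous_const.max continuous_norm) hmax
  have hs : Continuous s := by fun_prop
  obtain ⟨x, hx⟩ := exists_eq_zero_of_eq_id_off_ball
    (Q := fun x => (1 - s x) • P (c x • x) + s x • x)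
    (((continuous_const.sub hs).smul (hP.comp (hc.smul continuous_id))).add
      (hs.smul continuous_id)) (R := 2 * r) (by positivity) (fun x hx => by
        have h1 : 2 ≤ ‖x‖ / r := (le_div_iff₀ hr).2 hx
        have : s x = 1 := by
          simp only [s]
          rw [min_eq_left (by linarith), max_eq_right zero_le_one]
        simp [this])
  rcases le_or_gt ‖x‖ r with hxr | hxr
  · have h1 : ‖x‖ / r ≤ 1 := (div_le_one hr).2 hxr
    have hs0 : s x = 0 := max_eq_left ((min_le_right _ _).trans (by linarith))
    have hc1 : c x = 1 := by
      simp only [c]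
      rw [max_eq_left hxr, div_self hr.ne']
    simp only [hs0, hc1, sub_zero, one_smul, zero_smul, add_zero] at hx
    exact hne x hxr hx
  · have h1 : 1 < ‖x‖ / r := (one_lt_div hr).2 hxr
    have hs0 : 0 < s x := lt_max_of_lt_right (lt_min one_pos (by linarith))
    have hs1 : s x ≤ 1 := max_le zero_le_one (min_le_left _ _)
    have hc1 : c x = r / ‖x‖ := by
      simp only [c]
      rw [max_eq_right hxr.le]
    have hx0 : 0 < ‖x‖ := hr.trans hxr
    have hcx : 0 < c x := hc1 ▸ div_pos hr hx0
    have hnorm : ‖c x • x‖ = r := by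
      rw [norm_smul, Real.norm_of_nonneg hcx.le, hc1, div_mul_cancel₀ _ hx0.ne']
    have hP0 : 0 ≤ ⟪P (c x • x), x⟫ := by
      have := hpos _ hnorm
      rw [real_inner_smul_right] at this
      exact nonneg_of_mul_nonneg_right this hcx
    have hin := congrArg (fun y => ⟪y, x⟫) hx
    simp only [inner_add_left, real_inner_smul_left, inner_zero_left,
      real_inner_self_eq_norm_sq] at hin
    have h2 := mul_nonneg (sub_nonneg.2 hs1) hP0
    have h3 := mul_pos hs0 (pow_pos hx0 2)
    linarith
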